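/- arXiv:1510.08331 — 5 statements merged into one kernel-verified Lean document; each statement's English description precedes it below -/
import Mathlib

section
/- Let T be a Petri net of dimension d, let y ∈ ℕ^d be a configuration with 0 →T* y, and let t = (u,v) be a transition of T with pos(u) ⊆ pos(y). Then there exists a configuration y' ∈ ℕ^d with 0 →T* y' and pos(y') = pos(v) ∪ pos(y). -/
/-- A configuration of dimension `d` is a vector in `ℕ^d`. -/
abbrev Config (d : ℕ) := Fin d → ℕ

/-- A transition is a pair `(u, v)` of configurations. -/
abbrev Transition (d : ℕ) := Config d × Config d

/-- `x →t y` iff there exists `z` with `x = u + z` and `y = v + z` where `t = (u, v)`. -/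
def Step {d : ℕ} (t : Transition d) (x y : Config d) : Prop :=
  ∃ z : Config d, x = t.1 + z ∧ y = t.2 + z

/-- `x →w y` for a word `w = t₁…t_k` of transitions. -/
def Fire {d : ℕ} : List (Transition d) → Config d → Config d → Prop
  | [], x, y => x = y
  | t :: w, x, y => ∃ c, Step t x c ∧ Fire w c y

/-- `x →T* y`: reachability via a word over `T`. -/
def ReachStar {d : ℕ} (T : Finset (Transition d)) (x y : Config d) : Prop :=
  ∃ w : List (Transition d), (∀ t ∈ w, t ∈ T) ∧ Fire w x y

/-- `x →T+ y`: reachability via a nonempty word over `T`. -/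
def ReachPlus {d : ℕ} (T : Finset (Transition d)) (x y : Config d) : Prop :=
  ∃ w : List (Transition d), w ≠ [] ∧ (∀ t ∈ w, t ∈ T) ∧ Fire w x y

/-- A configuration `c` is cyclic for `T` if `c →T+ c`. -/
def Cyclic {d : ℕ} (T : Finset (Transition d)) (c : Config d) : Prop :=
  ReachPlus T c c

/-- `T` is structurally cyclic if every configuration is cyclic for `T`. -/
def StructurallyCyclic {d : ℕ} (T : Finset (Transition d)) : Prop :=
  ∀ c : Config d, Cyclic T c

/-- `pos c` is the set of indices where `c` is positive. -/
def pos {d : ℕ} (c : Config d) : Set (Fin d) := {i | 0 < c i}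

/-- `I₊(T)`: the forward markable indices. -/
def Iplus {d : ℕ} (T : Finset (Transition d)) : Set (Fin d) :=
  {i | ∃ c : Config d, ReachStar T 0 c ∧ i ∈ pos c}

/-- `I₋(T)`: the backward markable indices. -/
def Iminus {d : ℕ} (T : Finset (Transition d)) : Set (Fin d) :=
  {i | ∃ c : Config d, ReachStar T c 0 ∧ i ∈ pos c}

/-- `I(T) = I₊(T) ∩ I₋(T)`. -/
def Iboth {d : ℕ} (T : Finset (Transition d)) : Set (Fin d) :=
  Iplus T ∩ Iminus T

/-- `M(T)`: the mutually fireable transitions of `T`. -/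
def MSet {d : ℕ} (T : Finset (Transition d)) : Set (Transition d) :=
  {t | t ∈ T ∧ pos t.1 ∪ pos t.2 ⊆ Iboth T}

/-- `U(T)`: the ultimately cyclic transitions of `T`. -/
def USet {d : ℕ} (T : Finset (Transition d)) : Set (Transition d) :=
  {t | ∃ (w : List (Transition d)) (c : Config d),
        (∀ s ∈ w, s ∈ T) ∧ t ∈ w ∧ Fire w c c}

/-- `Λ(T)`: the transitions occurring in a nonempty word `w` with `0 →w 0`. -/
def LambdaSet {d : ℕ} (T : Finset (Transition d)) : Set (Transition d) :=
  {t | ∃ w : List (Transition d),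
        (∀ s ∈ w, s ∈ T) ∧ t ∈ w ∧ Fire w (0 : Config d) (0 : Config d)}

/-- The displacement `Δ(t) = v - u ∈ ℤ^d` of a transition `t = (u, v)`. -/
def Delta {d : ℕ} (t : Transition d) : Fin d → ℤ :=
  fun i => (t.2 i : ℤ) - (t.1 i : ℤ)

/-- The propagation map `prop_T`. -/
def propMap {d : ℕ} (T : Finset (Transition d)) (I : Set (Fin d)) : Set (Fin d) :=
  {i | ∃ t ∈ T, pos t.1 ⊆ I ∧ i ∈ pos t.2}

/-- A Petri net is lossy if it contains the transition `(e_i, 0)` for every index `i`. -/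
def Lossy {d : ℕ} (T : Finset (Transition d)) : Prop :=
  ∀ i : Fin d, ((Pi.single i 1 : Config d), (0 : Config d)) ∈ T

theorem fire_add_right {d : ℕ} (w : List (Transition d)) (z : Config d) :
    ∀ x y : Config d, Fire w x y → Fire w (x + z) (y + z) := by
  induction w with
  | nil => intro x y h; simp only [Fire] at h ⊢; rw [h]
  | cons t w ih =>
    rintro x y ⟨c, ⟨r, hx, hc⟩, h⟩
    exact ⟨c + z, ⟨r + z, by rw [hx, add_assoc], by rw [hc, add_assoc]⟩, ih _ _ h⟩

theorem fire_append {d : ℕ} (w w' : List (Transition d)) :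
    ∀ x y z : Config d, Fire w x y → Fire w' y z → Fire (w ++ w') x z := by
  induction w with
  | nil => intro x y z h h'; simp only [Fire] at h; subst h; exact h'
  | cons t w ih =>
    rintro x y z ⟨c, hs, h⟩ h'
    exact ⟨c, hs, ih _ _ _ h h'⟩

theorem reachStar_trans {d : ℕ} {T : Finset (Transition d)} {x y z : Config d}
    (h : ReachStar T x y) (h' : ReachStar T y z) : ReachStar T x z := by
  obtain ⟨w, hw, hf⟩ := h
  obtain ⟨w', hw', hf'⟩ := h'
  refine ⟨w ++ w', fun t ht => ?_, fire_append _ _ _ _ _ hf hf'⟩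
  rcases List.mem_append.1 ht with h | h
  · exact hw t h
  · exact hw' t h

theorem reachStar_nsmul {d : ℕ} {T : Finset (Transition d)} {y : Config d}
    (h : ReachStar T 0 y) (n : ℕ) : ReachStar T 0 (n • y) := by
  induction n with
  | zero => exact ⟨[], by simp, by simp [Fire]⟩
  | succ n ih =>
    refine reachStar_trans ih ?_
    obtain ⟨w, hw, hf⟩ := h
    refine ⟨w, hw, ?_⟩
    have := fire_add_right w (n • y) _ _ hf
    rwa [zero_add, add_comm, ← succ_nsmul] at this

/-- If `0 →T* y` and `t = (u,v) ∈ T` with `pos u ⊆ pos y`, then there is `y'` with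
`0 →T* y'` and `pos y' = pos v ∪ pos y`. -/
theorem exists_reachable_with_pos_union {d : ℕ} (T : Finset (Transition d))
    (y : Config d) (hy : ReachStar T (0 : Config d) y)
    (t : Transition d) (ht : t ∈ T) (hpos : pos t.1 ⊆ pos y) :
    ∃ y' : Config d, ReachStar T (0 : Config d) y' ∧ pos y' = pos t.2 ∪ pos y := by
  have key : ∀ i, t.1 i + y i ≤ ((∑ j, t.1 j) + 1) * y i := by
    intro i
    have h1 : t.1 i ≤ ∑ j, t.1 j :=
      Finset.single_le_sum (f := t.1) (fun _ _ => Nat.zero_le _) (Finset.mem_univ i)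
    rcases Nat.eq_zero_or_pos (t.1 i) with h0 | h0
    · rw [h0]; nlinarith [Nat.zero_le ((∑ j, t.1 j) * y i)]
    · have h2 : 0 < y i := hpos h0
      nlinarith
  have key2 : ∀ i, y i = 0 → t.1 i = 0 := by
    intro i hi
    by_contra h
    have h2 : 0 < y i := hpos (Nat.pos_of_ne_zero h)
    omega
  set n := (∑ j, t.1 j) + 1
  refine ⟨t.2 + fun i => n * y i - t.1 i, reachStar_trans (reachStar_nsmul hy n)
    ⟨[t], by simpa using ht, _, ⟨fun i => n * y i - t.1 i, ?_, rfl⟩, rfl⟩, ?_⟩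
  · funext i
    have := key i
    simp only [Pi.smul_apply, Pi.add_apply, smul_eq_mul]
    omega
  · ext i
    have h1 := key i
    have h2 : y i = 0 → n * y i = 0 := fun h => by rw [h, mul_zero]
    simp only [pos, Set.mem_setOf_eq, Set.mem_union, Pi.add_apply]
    omega
end

section
/- Let T be a Petri net of dimension d. A transition t ∈ T is ultimately cyclic if, and only if, there exists a function ψ : T → ℚ with ψ(t') ≥ 0 for all t' ∈ T, Σ_{t' ∈ T} ψ(t')·Δ(t') = 0, and ψ(t) > 0. -/
theorem fire_displacement {d : ℕ} (i : Fin d) (w : List (Transition d)) :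
    ∀ x y : Config d, Fire w x y →
      (w.map (fun t => (t.2 i : ℚ) - (t.1 i : ℚ))).sum = (y i : ℚ) - (x i : ℚ) := by
  induction w with
  | nil => intro x y h; simp only [Fire] at h; subst h; simp
  | cons t w ih =>
    rintro x y ⟨c, ⟨z, rfl, rfl⟩, hw⟩
    rw [List.map_cons, List.sum_cons, ih _ _ hw]
    simp only [Pi.add_apply]
    push_cast
    ring

theorem fire_sum {d : ℕ} (w : List (Transition d)) :
    ∀ z : Config d, Fire w ((w.map Prod.fst).sum + z) ((w.map Prod.snd).sum + z) := by
  induction w with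
  | nil => intro z; simp [Fire]
  | cons t w ih =>
    intro z
    refine ⟨t.2 + ((w.map Prod.fst).sum + z), ⟨(w.map Prod.fst).sum + z, ?_, rfl⟩, ?_⟩
    · simp [add_assoc]
    · have h := ih (t.2 + z)
      have e1 : t.2 + ((w.map Prod.fst).sum + z) = (w.map Prod.fst).sum + (t.2 + z) := by abel
      have e2 : ((t :: w).map Prod.snd).sum + z = (w.map Prod.snd).sum + (t.2 + z) := by
        rw [List.map_cons, List.sum_cons]; abel
      rw [e1, e2]; exact h

theorem exists_common_den {α : Type*} (T : Finset α) (ψ : α → ℚ) (h : ∀ s ∈ T, 0 ≤ ψ s) :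
    ∃ (D : ℕ) (n : α → ℕ), 0 < D ∧ ∀ s ∈ T, (n s : ℚ) = D * ψ s := by
  refine ⟨∏ s ∈ T, (ψ s).den,
    fun s => ((∏ s ∈ T, (ψ s).den) / (ψ s).den) * (ψ s).num.toNat,
    Finset.prod_pos fun s _ => (ψ s).den_pos, fun s hs => ?_⟩
  obtain ⟨k, hk⟩ : (ψ s).den ∣ ∏ s ∈ T, (ψ s).den :=
    Finset.dvd_prod_of_mem (fun s => (ψ s).den) hs
  simp only []
  rw [hk, Nat.mul_div_cancel_left _ (ψ s).den_pos]
  have h1 : (((ψ s).num.toNat : ℕ) : ℚ) = (ψ s).num := by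
    have := Int.toNat_of_nonneg (Rat.num_nonneg.2 (h s hs))
    exact_mod_cast this
  have h2 : ((ψ s).den : ℚ) * ψ s = (ψ s).num := Rat.den_mul_eq_num (ψ s)
  push_cast
  rw [h1, ← h2]
  ring

theorem exists_word {α M : Type*} [AddCommMonoid M] (T : Finset α) (n : α → ℕ) (f : α → M) :
    ((T.toList.flatMap fun s => List.replicate (n s) s).map f).sum = ∑ s ∈ T, n s • f s := by
  rw [← Finset.sum_map_toList T (fun s => n s • f s)]
  induction T.toList with
  | nil => simp
  | cons a l ih => simp [ih]

theorem exists_count {α : Type*} (T : Finset α) (w : List α) (hw : ∀ s ∈ w, s ∈ T) :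
    ∃ n : α → ℕ, (∀ s ∈ w, 0 < n s) ∧
      ∀ f : α → ℚ, ∑ s ∈ T, (n s : ℚ) * f s = (w.map f).sum := by
  classical
  refine ⟨fun s => w.count s, fun s hs => List.count_pos_iff.2 hs, fun f => ?_⟩
  rw [Finset.sum_list_map_count]
  simp only [nsmul_eq_mul]
  symm
  apply Finset.sum_subset
  · exact fun s hs => hw s (List.mem_toFinset.1 hs)
  · intro s _ hs
    rw [List.count_eq_zero_of_not_mem (fun h => hs (List.mem_toFinset.2 h))]
    simp

/-- A transition `t ∈ T` is ultimately cyclic iff there is a nonnegative rational solution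
`ψ` of `Σ_{t' ∈ T} ψ(t')·Δ(t') = 0` with `ψ(t) > 0`. -/
theorem ultimatelyCyclic_iff_rational_solution {d : ℕ} (T : Finset (Transition d))
    (t : Transition d) (ht : t ∈ T) :
    t ∈ USet T ↔
      ∃ ψ : Transition d → ℚ, (∀ t' ∈ T, 0 ≤ ψ t') ∧
        (∀ i : Fin d, ∑ t' ∈ T, ψ t' * ((t'.2 i : ℚ) - (t'.1 i : ℚ)) = 0) ∧
        0 < ψ t := by
  constructor
  · rintro ⟨w, c, hw, htw, hf⟩
    obtain ⟨n, hn, hsum⟩ := exists_count T w hw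
    refine ⟨fun s => (n s : ℚ), fun s _ => by positivity, fun i => ?_, ?_⟩
    · rw [hsum, fire_displacement i w c c hf, sub_self]
    · exact Nat.cast_pos.2 (hn t htw)
  · rintro ⟨ψ, h0, hs, hp⟩
    obtain ⟨D, n, hD, hn⟩ := exists_common_den T ψ h0
    set w := T.toList.flatMap fun s => List.replicate (n s) s with hw
    have heq : (w.map Prod.snd).sum = (w.map Prod.fst).sum := by
      rw [hw, exists_word T n (Prod.snd : Transition d → Config d),
        exists_word T n (Prod.fst : Transition d → Config d)]
      funext i
      have : (((∑ s ∈ T, n s • s.2) i : ℕ) : ℚ) - (((∑ s ∈ T, n s • s.1) i : ℕ) : ℚ) = 0 := by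
        simp only [Finset.sum_apply, Pi.smul_apply, smul_eq_mul]
        push_cast
        rw [← Finset.sum_sub_distrib]
        rw [← mul_zero (D : ℚ), ← hs i, Finset.mul_sum]
        refine Finset.sum_congr rfl fun s hs => ?_
        rw [hn s hs]; ring
      exact_mod_cast sub_eq_zero.1 this
    refine ⟨w, (w.map Prod.fst).sum, ?_, ?_, ?_⟩
    · intro s h
      simp only [hw, List.mem_flatMap, Finset.mem_toList, List.mem_replicate] at h
      obtain ⟨a, ha, _, rfl⟩ := h
      exact ha
    · simp only [hw, List.mem_flatMap, Finset.mem_toList, List.mem_replicate]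
      refine ⟨t, ht, ?_, rfl⟩
      intro h
      have h1 := hn t ht
      rw [h] at h1
      have : (0 : ℚ) < D * ψ t := by positivity
      simp at h1
      rcases h1 with h1 | h1
      · omega
      · exact hp.ne' h1
    · have h := fire_sum w 0
      rw [heq] at h
      simpa using h
end

section
/- Let T be a Petri net of dimension d such that T = M(T) ∩ U(T), i.e., every transition of T is both mutually fireable and ultimately cyclic. Then Λ(T) = T, i.e., every transition of T occurs in some nonempty word w over T with 0 →w 0. In particular, T is structurally cyclic if T is nonempty. -/
theorem Fire.append {d : ℕ} {w w' : List (Transition d)} {x y z : Config d}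
    (h : Fire w x y) (h' : Fire w' y z) : Fire (w ++ w') x z := by
  induction w generalizing x with
  | nil => simp only [Fire] at h; subst h; simpa using h'
  | cons t w ih =>
    obtain ⟨c, hc, hw⟩ := h
    exact ⟨c, hc, ih hw⟩

theorem Fire.add_right {d : ℕ} {w : List (Transition d)} {x y : Config d}
    (h : Fire w x y) (z : Config d) : Fire w (x + z) (y + z) := by
  induction w generalizing x with
  | nil => simp only [Fire] at h ⊢; rw [h]
  | cons t w ih =>
    obtain ⟨c, ⟨e, rfl, rfl⟩, hw⟩ := h
    exact ⟨_, ⟨e + z, by rw [add_assoc], by rw [add_assoc]⟩, ih hw⟩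

/-- Total displacement of a multiset of transitions. -/
def mDelta {d : ℕ} (m : Multiset (Transition d)) : Fin d → ℤ := (m.map Delta).sum

theorem Fire.delta {d : ℕ} {w : List (Transition d)} {x y : Config d}
    (h : Fire w x y) (i : Fin d) :
    mDelta (w : Multiset (Transition d)) i = (y i : ℤ) - x i := by
  induction w generalizing x with
  | nil => simp only [Fire] at h; subst h; simp [mDelta]
  | cons t w ih =>
    obtain ⟨c, ⟨e, rfl, rfl⟩, hw⟩ := h
    have := ih hw
    simp only [mDelta, Multiset.map_coe, Multiset.sum_coe, List.map_cons, List.sum_cons,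
      Pi.add_apply] at this ⊢
    rw [this]
    simp only [Delta]
    push_cast
    ring

/-- The `k`-fold repetition of a word. -/
def wpow {d : ℕ} (w : List (Transition d)) : ℕ → List (Transition d)
  | 0 => []
  | k + 1 => w ++ wpow w k

theorem mem_wpow {d : ℕ} {w : List (Transition d)} {k : ℕ} {t : Transition d}
    (h : t ∈ wpow w k) : t ∈ w := by
  induction k with
  | zero => simp [wpow] at h
  | succ k ih =>
    simp only [wpow, List.mem_append] at h
    exact h.elim id ih

theorem Fire.wpow {d : ℕ} {w : List (Transition d)} {x y : Config d}
    (h : Fire w x y) (k : ℕ) : Fire (wpow w k) (k • x) (k • y) := by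
  induction k with
  | zero => simp [_root_.wpow, Fire]
  | succ k ih =>
    have h1 := h.add_right (k • x)
    have h2 := ih.add_right y
    rw [succ_nsmul', succ_nsmul]
    rw [add_comm y] at h1
    exact h1.append h2

theorem exists_bound {d : ℕ} (I : Set (Fin d)) (w : List (Transition d))
    (hw : ∀ t ∈ w, pos t.1 ⊆ I) :
    ∃ K : ℕ, ∀ x : Config d, (∀ i ∈ I, K ≤ x i) → ∃ y, Fire w x y := by
  induction w with
  | nil => exact ⟨0, fun x _ => ⟨x, rfl⟩⟩
  | cons t w ih =>
    obtain ⟨K, hK⟩ := ih (fun s hs => hw s (List.mem_cons_of_mem _ hs))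
    refine ⟨K + ∑ i, t.1 i, fun x hx => ?_⟩
    have hs : ∀ i, t.1 i ≤ ∑ i, t.1 i := fun i =>
      Finset.single_le_sum (f := t.1) (fun _ _ => Nat.zero_le _) (Finset.mem_univ i)
    have hle : ∀ i, t.1 i ≤ x i := by
      intro i
      by_cases hi : 0 < t.1 i
      · have := hx i (hw t List.mem_cons_self hi)
        have := hs i
        omega
      · omega
    obtain ⟨y, hy⟩ := hK (t.2 + (x - t.1)) (by
      intro i hi
      have := hx i hi
      have := hs i
      simp only [Pi.add_apply, Pi.sub_apply]
      omega)
    refine ⟨y, _, ⟨x - t.1, ?_, rfl⟩, hy⟩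
    funext i
    have := hle i
    simp only [Pi.add_apply, Pi.sub_apply]
    omega

theorem fire_middle {d : ℕ} (I : Set (Fin d)) (w : List (Transition d)) (x y : Config d)
    (hx : ∀ i ∈ I, 0 < x i) (hy : ∀ i ∈ I, 0 < y i)
    (hd : ∀ i, mDelta (w : Multiset (Transition d)) i = (y i : ℤ) - x i)
    (K : ℕ) (hK : ∀ x : Config d, (∀ i ∈ I, K ≤ x i) → ∃ y, Fire w x y) (j : ℕ) :
    ∀ b : ℕ, K ≤ j + b → Fire (wpow w j) (j • x + b • y) ((b + j) • y) := by
  induction j with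
  | zero => intro b _; simp [wpow, Fire]
  | succ j ih =>
    intro b hb
    obtain ⟨q, hq⟩ := hK ((j + 1) • x + b • y) (by
      intro i hi
      have h1 := hx i hi
      have h2 := hy i hi
      simp only [Pi.add_apply, Pi.smul_apply, smul_eq_mul]
      have := Nat.le_mul_of_pos_right (j + 1) h1
      have := Nat.le_mul_of_pos_right b h2
      omega)
    have hq' : q = j • x + (b + 1) • y := by
      funext i
      have h1 := hq.delta i
      rw [hd i] at h1
      simp only [Pi.add_apply, Pi.smul_apply, smul_eq_mul] at h1 ⊢
      zify
      push_cast at h1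
      linarith
    rw [hq'] at hq
    have := ih (b + 1) (by omega)
    rw [show b + 1 + j = b + (j + 1) by ring] at this
    exact hq.append this

theorem exists_forward {d : ℕ} (T : Finset (Transition d)) (s : Finset (Fin d))
    (hs : ∀ i ∈ s, i ∈ Iplus T) :
    ∃ (w : List (Transition d)) (x : Config d), (∀ t ∈ w, t ∈ T) ∧ Fire w 0 x ∧
      ∀ i ∈ s, 0 < x i := by
  classical
  induction s using Finset.induction_on with
  | empty => exact ⟨[], 0, by simp, rfl, by simp⟩
  | insert a s _ ih =>
    obtain ⟨w, x, hw, hf, hp⟩ := ih (fun i hi => hs i (Finset.mem_insert_of_mem hi))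
    obtain ⟨c, ⟨w', hw', hf'⟩, hc⟩ := hs a (Finset.mem_insert_self _ _)
    have h2 := hf'.add_right x
    rw [zero_add] at h2
    refine ⟨w ++ w', c + x, ?_, hf.append h2, ?_⟩
    · intro t ht
      exact (List.mem_append.1 ht).elim (hw t) (hw' t)
    · intro i hi
      rcases Finset.mem_insert.1 hi with rfl | hi
      · exact Nat.add_pos_left hc _
      · exact Nat.add_pos_right _ (hp i hi)

theorem exists_backward {d : ℕ} (T : Finset (Transition d)) (s : Finset (Fin d))
    (hs : ∀ i ∈ s, i ∈ Iminus T) :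
    ∃ (w : List (Transition d)) (x : Config d), (∀ t ∈ w, t ∈ T) ∧ Fire w x 0 ∧
      ∀ i ∈ s, 0 < x i := by
  classical
  induction s using Finset.induction_on with
  | empty => exact ⟨[], 0, by simp, rfl, by simp⟩
  | insert a s _ ih =>
    obtain ⟨w, x, hw, hf, hp⟩ := ih (fun i hi => hs i (Finset.mem_insert_of_mem hi))
    obtain ⟨c, ⟨w', hw', hf'⟩, hc⟩ := hs a (Finset.mem_insert_self _ _)
    have h2 := hf'.add_right x
    rw [zero_add] at h2
    refine ⟨w' ++ w, c + x, ?_, h2.append hf, ?_⟩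
    · intro t ht
      exact (List.mem_append.1 ht).elim (hw' t) (hw t)
    · intro i hi
      rcases Finset.mem_insert.1 hi with rfl | hi
      · exact Nat.add_pos_left hc _
      · exact Nat.add_pos_right _ (hp i hi)

theorem mDelta_add {d : ℕ} (a b : Multiset (Transition d)) :
    mDelta (a + b) = mDelta a + mDelta b := by simp [mDelta]

theorem mDelta_nsmul {d : ℕ} (n : ℕ) (a : Multiset (Transition d)) :
    mDelta (n • a) = n • mDelta a := by
  simp [mDelta, Multiset.map_nsmul, Multiset.sum_nsmul]

theorem exists_cycle {d : ℕ} (T s : Finset (Transition d))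
    (hs : ∀ t ∈ s, t ∈ USet T) :
    ∃ m : Multiset (Transition d), (∀ t ∈ m, t ∈ T) ∧ mDelta m = 0 ∧ ∀ t ∈ s, t ∈ m := by
  classical
  induction s using Finset.induction_on with
  | empty => exact ⟨0, by simp, by simp [mDelta], by simp⟩
  | insert a s _ ih =>
    obtain ⟨m, hm, hd, hp⟩ := ih (fun i hi => hs i (Finset.mem_insert_of_mem hi))
    obtain ⟨w, c, hw, ha, hf⟩ := hs a (Finset.mem_insert_self _ _)
    refine ⟨(w : Multiset (Transition d)) + m, ?_, ?_, ?_⟩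
    · intro t ht
      exact (Multiset.mem_add.1 ht).elim (fun h => hw t (by simpa using h)) (hm t)
    · rw [mDelta_add, hd]
      funext i
      simp [hf.delta i]
    · intro i hi
      rcases Finset.mem_insert.1 hi with rfl | hi
      · exact Multiset.mem_add.2 (Or.inl (by simpa using ha))
      · exact Multiset.mem_add.2 (Or.inr (hp i hi))

theorem exists_zero_cycle {d : ℕ} (T : Finset (Transition d))
    (hM : ∀ t ∈ T, t ∈ MSet T) (hU : ∀ t ∈ T, t ∈ USet T) :
    ∃ w : List (Transition d), (∀ s ∈ w, s ∈ T) ∧ (∀ t ∈ T, t ∈ w) ∧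
      Fire w (0 : Config d) (0 : Config d) := by
  classical
  obtain ⟨α, x, hα, hfα, hx⟩ := exists_forward T (Finset.univ.filter (· ∈ Iboth T))
    (fun i hi => (Finset.mem_filter.1 hi).2.1)
  obtain ⟨β, y, hβ, hfβ, hy⟩ := exists_backward T (Finset.univ.filter (· ∈ Iboth T))
    (fun i hi => (Finset.mem_filter.1 hi).2.2)
  have hx' : ∀ i ∈ Iboth T, 0 < x i := fun i hi => hx i (by simpa using hi)
  have hy' : ∀ i ∈ Iboth T, 0 < y i := fun i hi => hy i (by simpa using hi)
  obtain ⟨m, hm, hmd, hmT⟩ := exists_cycle T T hU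
  obtain ⟨A, hA⟩ : ∃ A : Multiset (Transition d), A = (α : Multiset _) + (β : Multiset _) :=
    ⟨_, rfl⟩
  have hAT : ∀ t ∈ A, t ∈ T := by
    intro t ht
    rw [hA] at ht
    exact (Multiset.mem_add.1 ht).elim (fun h => hα t (by simpa using h))
      (fun h => hβ t (by simpa using h))
  have hcount : ∀ t ∈ T, A.count t < ((A.card + 1) • m).count t := by
    intro t ht
    rw [Multiset.count_nsmul]
    have h1 := Multiset.count_le_card t A
    have h2 := Multiset.count_pos.2 (hmT t ht)
    have := Nat.le_mul_of_pos_right (A.card + 1) h2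
    omega
  have hle : A ≤ (A.card + 1) • m := by
    rw [Multiset.le_iff_count]
    intro t
    by_cases ht : t ∈ A
    · exact (hcount t (hAT t ht)).le
    · rw [Multiset.count_eq_zero_of_notMem ht]; exact Nat.zero_le _
  obtain ⟨G, hG⟩ := Multiset.le_iff_exists_add.1 hle
  have hGT : ∀ t ∈ G, t ∈ T := by
    intro t ht
    have : t ∈ (A.card + 1) • m := by rw [hG]; exact Multiset.mem_add.2 (Or.inr ht)
    exact hm t (Multiset.mem_of_mem_nsmul this)
  have hTG : ∀ t ∈ T, t ∈ G := by
    intro t ht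
    have := hcount t ht
    rw [hG, Multiset.count_add] at this
    exact Multiset.count_pos.1 (by omega)
  have hGd : ∀ i, mDelta (G.toList : Multiset (Transition d)) i = (y i : ℤ) - x i := by
    intro i
    have h1 := congrFun (congrArg mDelta hG) i
    rw [mDelta_nsmul, hmd, hA, mDelta_add, mDelta_add] at h1
    simp only [Pi.add_apply, hfα.delta i, hfβ.delta i] at h1
    rw [Multiset.coe_toList]
    simp at h1
    linarith
  obtain ⟨K, hK⟩ := exists_bound (Iboth T) G.toList (fun t ht =>
    Set.subset_union_left.trans (hM t (hGT t (Multiset.mem_toList.1 ht))).2)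
  have hmid := fire_middle (Iboth T) G.toList x y hx' hy' hGd K hK (K + 1) 0 (by omega)
  rw [zero_nsmul, add_zero, zero_add] at hmid
  have h1 := hfα.wpow (K + 1)
  have h2 := hfβ.wpow (K + 1)
  rw [nsmul_zero] at h1 h2
  refine ⟨_, ?_, ?_, (h1.append hmid).append h2⟩
  · intro s hs
    rcases List.mem_append.1 hs with hs | hs
    · rcases List.mem_append.1 hs with hs | hs
      · exact hα s (mem_wpow hs)
      · exact hGT s (Multiset.mem_toList.1 (mem_wpow hs))
    · exact hβ s (mem_wpow hs)
  · intro t ht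
    refine List.mem_append.2 (Or.inl (List.mem_append.2 (Or.inr ?_)))
    exact List.mem_append.2 (Or.inl (Multiset.mem_toList.2 (hTG t ht)))

/-- If `T = M(T) ∩ U(T)` then `Λ(T) = T`; in particular `T` is structurally cyclic if `T`
is nonempty. -/
theorem lambda_eq_of_mutuallyFireable_and_ultimatelyCyclic {d : ℕ}
    (T : Finset (Transition d))
    (h : (T : Set (Transition d)) = MSet T ∩ USet T) :
    LambdaSet T = (T : Set (Transition d)) ∧
      (T.Nonempty → StructurallyCyclic T) := by
  have hMU : ∀ t ∈ T, t ∈ MSet T ∩ USet T := fun t ht => h ▸ (Finset.mem_coe.2 ht)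
  obtain ⟨w, hw, hT, hf⟩ := exists_zero_cycle T (fun t ht => (hMU t ht).1)
    (fun t ht => (hMU t ht).2)
  refine ⟨Set.Subset.antisymm ?_ ?_, ?_⟩
  · rintro t ⟨w', hw', ht, _⟩
    exact hw' t ht
  · intro t ht
    exact ⟨w, hw, hT t ht, hf⟩
  · rintro ⟨t, ht⟩ c
    refine ⟨w, List.ne_nil_of_mem (hT t ht), hw, ?_⟩
    simpa using hf.add_right c
end

section
/- Let T be a lossy Petri net of dimension d and let x, y ∈ ℕ^d be configurations. Define the Petri net S of dimension d+1 as S = {s_down, s_reset} ∪ φ(T), where φ(u,v) = ((u,0),(v,1)), s_down = ((y,1),(y,0)), and s_reset = ((y,0),(x,0)) (here (c,n) denotes the vector of ℕ^{d+1} extending c ∈ ℕ^d by the value n in the last coordinate). Then x →T* y if, and only if, the configuration (x,0) is cyclic for S. -/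
theorem ReachStar.of_step {d : ℕ} {T : Finset (Transition d)} {t : Transition d} {x c y : Config d}
    (ht : t ∈ T) (h : Step t x c) (hr : ReachStar T c y) : ReachStar T x y := by
  obtain ⟨w, hw, hf⟩ := hr
  exact ⟨t :: w, List.forall_mem_cons.mpr ⟨ht, hw⟩, c, h, hf⟩

theorem ReachStar.refl' {d : ℕ} (T : Finset (Transition d)) (x : Config d) : ReachStar T x x :=
  ⟨[], by simp, rfl⟩

theorem lossy_drop {d : ℕ} (T : Finset (Transition d)) (hT : Lossy T) (y : Config d) :
    ∀ (n : ℕ) (z : Config d), ∑ i, z i = n → ReachStar T (y + z) y := by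
  intro n
  induction n with
  | zero =>
    intro z hz
    have : z = 0 := by
      funext i
      have := (Finset.sum_eq_zero_iff.mp hz) i (Finset.mem_univ i)
      simpa using this
    subst this
    simpa using ReachStar.refl' T y
  | succ n ih =>
    intro z hz
    obtain ⟨i, -, hi⟩ : ∃ i ∈ Finset.univ, z i ≠ 0 := by
      apply Finset.exists_ne_zero_of_sum_ne_zero
      omega
    have hz' : z = Pi.single i 1 + (z - Pi.single i 1) := by
      funext j
      by_cases h : j = i
      · subst h; simp; omega
      · simp [h]
    have hs : ∑ j, (z - Pi.single i 1 : Config d) j = n := by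
      have h1 : ∑ j, z j = ∑ j, ((Pi.single i 1 : Config d) j + (z - Pi.single i 1 : Config d) j) :=
        Finset.sum_congr rfl fun j _ => congrFun hz' j
      rw [Finset.sum_add_distrib, Finset.sum_pi_single'] at h1
      simp only [Finset.mem_univ, if_true] at h1
      omega
    refine ReachStar.of_step (hT i) ⟨y + (z - Pi.single i 1), ?_, ?_⟩ (ih _ hs)
    · show y + z = Pi.single i 1 + (y + (z - Pi.single i 1))
      conv_lhs => rw [hz']
      rw [add_left_comm]
    · simp

/-- The net of the reduction. -/
abbrev redNet {d : ℕ} (T : Finset (Transition d)) (x y : Config d) : Finset (Transition (d + 1)) :=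
  insert ((Fin.snoc y 1, Fin.snoc y 0) : Transition (d + 1))
    (insert ((Fin.snoc y 0, Fin.snoc x 0) : Transition (d + 1))
      (T.image (fun t => ((Fin.snoc t.1 0, Fin.snoc t.2 1) : Transition (d + 1)))))

theorem init_snoc_add {d : ℕ} (u : Config d) (n : ℕ) (z : Config (d + 1)) :
    (fun i : Fin d => ((Fin.snoc u n : Config (d + 1)) + z) i.castSucc)
      = u + fun i => z i.castSucc := by
  funext i
  simp

theorem back {d : ℕ} (T : Finset (Transition d)) (hT : Lossy T) (x y : Config d) :
    ∀ (w : List (Transition (d + 1))) (a b : Config (d + 1)),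
      (∀ t ∈ w, t ∈ redNet T x y) → Fire w a b →
      ReachStar T (fun i => a i.castSucc) y ∨ b (Fin.last d) = a (Fin.last d) + w.length := by
  intro w
  induction w with
  | nil => intro a b _ h; right; cases h; simp
  | cons t w ih =>
    rintro a b hw ⟨c, ⟨z, h1, h2⟩, hf⟩
    have ht := hw t (by simp)
    have IH := ih c b (fun s hs => hw s (by simp [hs])) hf
    simp only [redNet, Finset.mem_insert, Finset.mem_image] at ht
    rcases ht with rfl | rfl | ⟨t, htT, rfl⟩
    · left
      rw [h1, init_snoc_add]
      exact lossy_drop T hT y _ _ rfl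
    · left
      rw [h1, init_snoc_add]
      exact lossy_drop T hT y _ _ rfl
    · rcases IH with IH | IH
      · left
        refine ReachStar.of_step htT ⟨fun i => z i.castSucc, ?_, ?_⟩ IH
        · rw [h1, init_snoc_add]
        · rw [h2, init_snoc_add]
      · right
        rw [IH, h1, h2]
        simp
        omega

theorem snoc_add' {d : ℕ} (u v : Config d) (n m : ℕ) :
    (Fin.snoc (u + v) (n + m) : Config (d + 1)) = Fin.snoc u n + Fin.snoc v m := by
  funext i
  refine Fin.lastCases ?_ (fun i => ?_) i <;> simp

theorem down_reach {d : ℕ} (T : Finset (Transition d)) (x y : Config d) (n : ℕ) :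
    ReachPlus (redNet T x y) (Fin.snoc y n) (Fin.snoc x 0) := by
  induction n with
  | zero =>
    refine ⟨[(Fin.snoc y 0, Fin.snoc x 0)], by simp, by simp [redNet], _, ⟨0, ?_, rfl⟩, ?_⟩
    · simp
    · simp [Fire]
  | succ n ih =>
    obtain ⟨w, -, hw, hf⟩ := ih
    refine ⟨(Fin.snoc y 1, Fin.snoc y 0) :: w, by simp, ?_, _, ⟨Fin.snoc 0 n, ?_, ?_⟩, hf⟩
    · intro t ht
      rcases List.mem_cons.mp ht with rfl | ht
      · simp [redNet]
      · exact hw t ht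
    · rw [← snoc_add', add_zero, add_comm 1 n]
    · rw [← snoc_add', add_zero, zero_add]

theorem forw {d : ℕ} (T : Finset (Transition d)) (x y : Config d) :
    ∀ (w : List (Transition d)) (a : Config d) (n : ℕ), (∀ t ∈ w, t ∈ T) → Fire w a y →
      ReachPlus (redNet T x y) (Fin.snoc a n) (Fin.snoc x 0) := by
  intro w
  induction w with
  | nil => intro a n _ h; cases h; exact down_reach T x y n
  | cons t w ih =>
    rintro a n hw ⟨c, ⟨z, h1, h2⟩, hf⟩
    obtain ⟨v, -, hv, hvf⟩ := ih c (n + 1) (fun s hs => hw s (by simp [hs])) hf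
    refine ⟨(Fin.snoc t.1 0, Fin.snoc t.2 1) :: v, by simp, ?_, _, ⟨Fin.snoc z n, ?_, ?_⟩, hvf⟩
    · intro s hs
      rcases List.mem_cons.mp hs with rfl | hs
      · refine Finset.mem_insert_of_mem (Finset.mem_insert_of_mem ?_)
        exact Finset.mem_image.mpr ⟨t, hw t (by simp), rfl⟩
      · exact hv s hs
    · rw [← snoc_add', zero_add, h1]
    · rw [← snoc_add', h2, add_comm n 1]

/-- Reduction of reachability for lossy Petri nets to cyclicity: `x →T* y` iff `(x,0)` is
cyclic for `S = {s_down, s_reset} ∪ φ(T)`. -/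
theorem lossy_reach_iff_cyclic {d : ℕ} (T : Finset (Transition d)) (hT : Lossy T)
    (x y : Config d) :
    ReachStar T x y ↔
      Cyclic
        (insert ((Fin.snoc y 1, Fin.snoc y 0) : Transition (d + 1))
          (insert ((Fin.snoc y 0, Fin.snoc x 0) : Transition (d + 1))
            (T.image (fun t => ((Fin.snoc t.1 0, Fin.snoc t.2 1) : Transition (d + 1))))))
        (Fin.snoc x 0) := by
  constructor
  · rintro ⟨w, hw, hf⟩
    exact forw T x y w x 0 hw hf
  · rintro ⟨w, hne, hw, hf⟩
    rcases back T hT x y w _ _ hw hf with h | h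
    · simpa using h
    · exact absurd (List.length_eq_zero_iff.mp (by omega)) hne
end

section
/- Let G be a context-free grammar with nonterminals {1,…,d}, empty terminal alphabet, productions P, and initial nonterminal S = 1. Let ψ(w) ∈ ℕ^d denote the Parikh image of a word w over the nonterminals. Define the Petri net T of dimension d as T = T₀ ∪ {t₀}, where T₀ = {(ψ(l), ψ(r)) : (l → r) ∈ P} and t₀ = (0, ψ(S)) = (0, (1,0,…,0)). Then the empty word ε belongs to the language generated by G if, and only if, T is structurally cyclic (equivalently, 0 →T+ 0). -/
/-- Parikh image of a string of symbols (with empty terminal alphabet),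
counting occurrences of each nonterminal. -/
def symParikh {d : ℕ} (w : List (Symbol Empty (Fin d))) : Config d :=
  fun i => w.count (Symbol.nonterminal i)

lemma symParikh_append_aux {d : ℕ} (u v : List (Symbol Empty (Fin d))) :
    symParikh (u ++ v) = symParikh u + symParikh v := by
  funext i
  simp [symParikh]

lemma symParikh_single_aux {d : ℕ} (j : Fin d) :
    symParikh [(Symbol.nonterminal j : Symbol Empty (Fin d))] = Pi.single j 1 := by
  funext i
  by_cases hij : i = j
  · subst hij
    simp [symParikh]
  · have hji : ¬ j = i := fun h => hij h.symm
    simp [symParikh, List.count_singleton, Pi.single_apply, hij, hji]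

lemma symParikh_nil_aux {d : ℕ} :
    symParikh ([] : List (Symbol Empty (Fin d))) = 0 := by
  funext i
  simp [symParikh]

/-- A derivation is simulated by the Petri net, in any context. -/
lemma fire_of_derives_aux {d : ℕ} (S : Fin d) (P : Finset (ContextFreeRule Empty (Fin d)))
    (u v : List (Symbol Empty (Fin d)))
    (h : (ContextFreeGrammar.mk (Fin d) S P).Derives u v) (c : Config d) :
    ∃ w : List (Transition d),
      (∀ t ∈ w, t ∈ P.image (fun r =>
        (((Pi.single r.input 1 : Config d), symParikh r.output) : Transition d))) ∧
      Fire w (symParikh u + c) (symParikh v + c) := by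
  induction h using Relation.ReflTransGen.head_induction_on with
  | refl => exact ⟨[], by simp, rfl⟩
  | head h1 _ ih =>
    obtain ⟨r, hr, hrw⟩ := h1
    obtain ⟨p, q, rfl, rfl⟩ := hrw.exists_parts
    obtain ⟨w, hw, hf⟩ := ih
    refine ⟨(Pi.single r.input 1, symParikh r.output) :: w, ?_, _, ?_, hf⟩
    · intro t ht
      rcases List.mem_cons.1 ht with rfl | ht
      · exact Finset.mem_image_of_mem _ hr
      · exact hw t ht
    · refine ⟨symParikh p + symParikh q + c, ?_, ?_⟩
      · have h1 := symParikh_append_aux (p ++ [Symbol.nonterminal r.input]) q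
        have h2 := symParikh_append_aux p [Symbol.nonterminal r.input]
        have h3 := symParikh_single_aux r.input
        erw [h1, h2, h3]
        simp only []
        abel
      · have h1 := symParikh_append_aux (p ++ r.output) q
        have h2 := symParikh_append_aux p r.output
        erw [h1, h2]
        simp only []
        abel

/-- A word all of whose nonterminals are nullable is nullable. -/
lemma derives_nil_aux {d : ℕ} (S : Fin d) (P : Finset (ContextFreeRule Empty (Fin d)))
    (u : List (Symbol Empty (Fin d)))
    (h : ∀ i, Symbol.nonterminal i ∈ u →
      (ContextFreeGrammar.mk (Fin d) S P).Derives [Symbol.nonterminal i] []) :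
    (ContextFreeGrammar.mk (Fin d) S P).Derives u [] := by
  induction u with
  | nil => exact Relation.ReflTransGen.refl
  | cons a u ih =>
    have h2 := ih (fun i hi => h i (List.mem_cons_of_mem _ hi))
    cases a with
    | terminal e => exact e.elim
    | nonterminal i =>
      have h1 := (h i (by simp)).append_right u
      exact h1.trans h2

/-- Every index marked in a configuration from which `0` is reachable is nullable. -/
lemma nullable_of_fire_aux {d : ℕ} (S : Fin d) (P : Finset (ContextFreeRule Empty (Fin d)))
    (w : List (Transition d)) :
    ∀ x : Config d,
    (∀ t ∈ w, t ∈ insert (((0 : Config d), (Pi.single S 1 : Config d)) : Transition d)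
      (P.image (fun r =>
        (((Pi.single r.input 1 : Config d), symParikh r.output) : Transition d)))) →
    Fire w x 0 → ∀ i, 0 < x i →
      (ContextFreeGrammar.mk (Fin d) S P).Derives [Symbol.nonterminal i] [] := by
  induction w with
  | nil =>
    intro x _ hf i hi
    have hx : x = 0 := hf
    simp [hx] at hi
  | cons t w ih =>
    rintro x hw ⟨c, ⟨z, hx, hc⟩, hf⟩ i hi
    have ih' := ih c (fun s hs => hw s (List.mem_cons_of_mem _ hs)) hf
    have hz : ∀ j, 0 < z j → 0 < c j := by
      intro j hj
      rw [hc, Pi.add_apply]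
      omega
    rcases Finset.mem_insert.1 (hw t (by simp)) with rfl | ht
    · apply ih' i
      apply hz
      simpa [hx] using hi
    · obtain ⟨r, hr, rfl⟩ := Finset.mem_image.1 ht
      by_cases hir : i = r.input
      · subst hir
        refine ContextFreeGrammar.Produces.trans_derives
          ⟨r, hr, ContextFreeRule.Rewrites.input_output⟩ ?_
        apply derives_nil_aux
        intro j hj
        apply ih' j
        rw [hc, Pi.add_apply]
        have : 0 < symParikh r.output j := List.count_pos_iff.2 hj
        exact Nat.add_pos_left this _
      · apply ih' i
        apply hz
        simpa [hx, Pi.single_apply, hir] using hi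

/-- `ε ∈ L(G)` iff the Petri net `T = T₀ ∪ {t₀}`, where
`T₀ = {(ψ(l), ψ(r)) : (l → r) ∈ P}` and `t₀ = (0, ψ(S))`, is structurally cyclic. -/
theorem epsilon_mem_language_iff_structurallyCyclic {d : ℕ} (S : Fin d)
    (P : Finset (ContextFreeRule Empty (Fin d))) :
    ([] : List Empty) ∈ (ContextFreeGrammar.mk (Fin d) S P).language ↔
      StructurallyCyclic
        (insert (((0 : Config d), (Pi.single S 1 : Config d)) : Transition d)
          (P.image (fun r =>
            (((Pi.single r.input 1 : Config d), symParikh r.output) : Transition d)))) := by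
  constructor
  · intro h c
    have h' : (ContextFreeGrammar.mk (Fin d) S P).Derives [Symbol.nonterminal S] [] := h
    obtain ⟨w, hw, hf⟩ := fire_of_derives_aux S P _ _ h' c
    rw [symParikh_single_aux, symParikh_nil_aux, zero_add] at hf
    refine ⟨(0, Pi.single S 1) :: w, by simp, ?_, _, ⟨c, by simp, rfl⟩, hf⟩
    intro t ht
    rcases List.mem_cons.1 ht with rfl | ht
    · exact Finset.mem_insert_self _ _
    · exact Finset.mem_insert_of_mem (hw t ht)
  · intro h
    obtain ⟨w, hne, hw, hf⟩ := h 0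
    cases w with
    | nil => exact absurd rfl hne
    | cons t w =>
      obtain ⟨c, ⟨z, hx, hc⟩, hf⟩ := hf
      have key := nullable_of_fire_aux S P w c
        (fun s hs => hw s (List.mem_cons_of_mem _ hs)) hf S
      rcases Finset.mem_insert.1 (hw t (by simp)) with rfl | ht
      · apply key
        simp [hc]
      · obtain ⟨r, hr, rfl⟩ := Finset.mem_image.1 ht
        have := congrFun hx r.input
        simp at this
        omega
end
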